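/- arXiv:1907.07452 — 2 statements merged into one kernel-verified Lean document; each statement's English description precedes it below -/
import Mathlib

section
/- Let φ and z be smooth (z with values in ℂ³), let ε ∈ (0,1], h > 0, η = h/ε, and let k be an integer; set y(t) = e^{ikφ(t)/ε} z(t). Then there exists a constant C, depending only on |k|, an upper bound for η, and bounds for φ and z and their derivatives up to order 3 on [t−h, t+h], such that | (y(t+h) − y(t−h))/(2h) − e^{ikφ(t)/ε} [ ( (i/(εη)) sin(kη φ̇(t)) − (kη/2) sin(kη φ̇(t)) φ̈(t) ) z(t) + cos(kη φ̇(t)) ż(t) ] | ≤ C ε. -/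
noncomputable section

lemma aux_mv {E : Type*} [NormedAddCommGroup E] [NormedSpace ℝ E] (g : ℝ → E) (t h B : ℝ)
    (hh : 0 < h) (hB : 0 ≤ B) (hg : Differentiable ℝ g)
    (hb : ∀ s ∈ Set.Icc (t - h) (t + h), ‖deriv g s‖ ≤ B) :
    ∀ x ∈ Set.Icc (t - h) (t + h), ‖g x - g t‖ ≤ B * h := by
  intro x hx
  have h1 := Convex.norm_image_sub_le_of_norm_deriv_le (f := g) (C := B)
    (s := Set.Icc (t - h) (t + h)) (x := t) (y := x) (fun y _ => hg y) hb (convex_Icc _ _)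
    ⟨by linarith, by linarith⟩ hx
  refine h1.trans (mul_le_mul_of_nonneg_left ?_ hB)
  rw [Real.norm_eq_abs, abs_le]
  exact ⟨by linarith [hx.1], by linarith [hx.2]⟩

lemma aux_t2 {E : Type*} [NormedAddCommGroup E] [NormedSpace ℝ E] (f : ℝ → E) (t h B : ℝ)
    (hh : 0 < h) (hB : 0 ≤ B) (hf : Differentiable ℝ f) (hf' : Differentiable ℝ (deriv f))
    (hb : ∀ s ∈ Set.Icc (t - h) (t + h), ‖deriv (deriv f) s‖ ≤ B) :
    ∀ x ∈ Set.Icc (t - h) (t + h), ‖f x - f t - (x - t) • deriv f t‖ ≤ B * h ^ 2 := by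
  intro x hx
  have hd : ∀ s, HasDerivAt (fun x => f x - (x - t) • deriv f t) (deriv f s - deriv f t) s := by
    intro s
    have h2 := (((hasDerivAt_id s).sub_const t).smul_const (deriv f t))
    have := (hf s).hasDerivAt.sub h2
    refine this.congr_deriv ?_
    simp
  have := aux_mv (fun x => f x - (x - t) • deriv f t) t h (B * h) hh (by positivity)
    (fun s => (hd s).differentiableAt)
    (fun s hs => by rw [(hd s).deriv]; exact aux_mv (deriv f) t h B hh hB hf' hb s hs) x hx
  simp only [sub_self, zero_smul, sub_zero] at this
  calc _ = ‖f x - (x - t) • deriv f t - f t‖ := by congr 1; abel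
    _ ≤ _ := this
    _ = _ := by ring

lemma aux_t3 (f : ℝ → ℝ) (t h B : ℝ)
    (hh : 0 < h) (hB : 0 ≤ B) (hf : Differentiable ℝ f) (hf' : Differentiable ℝ (deriv f))
    (hf'' : Differentiable ℝ (deriv (deriv f)))
    (hb : ∀ s ∈ Set.Icc (t - h) (t + h), ‖deriv (deriv (deriv f)) s‖ ≤ B) :
    ∀ x ∈ Set.Icc (t - h) (t + h),
      |f x - f t - (x - t) * deriv f t - (x - t) ^ 2 / 2 * deriv (deriv f) t| ≤ B * h ^ 3 := by
  intro x hx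
  have hd : ∀ s, HasDerivAt
      (fun x => f x - (x - t) * deriv f t - (x - t) ^ 2 / 2 * deriv (deriv f) t)
      (deriv f s - deriv f t - (s - t) • deriv (deriv f) t) s := by
    intro s
    have h2 := (((hasDerivAt_id s).sub_const t).mul_const (deriv f t))
    have h3 := (((((hasDerivAt_id s).sub_const t).pow 2).div_const 2).mul_const
      (deriv (deriv f) t))
    have := ((hf s).hasDerivAt.sub h2).sub h3
    refine this.congr_deriv ?_
    simp
  have := aux_mv _ t h (B * h ^ 2) hh (by positivity)
    (fun s => (hd s).differentiableAt)
    (fun s hs => by rw [(hd s).deriv]; exact aux_t2 (deriv f) t h B hh hB hf' hf'' hb s hs) x hx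
  simp only [sub_self, zero_mul, sub_zero, Real.norm_eq_abs] at this
  calc _ = |f x - (x - t) * deriv f t - (x - t) ^ 2 / 2 * deriv (deriv f) t
          - (f t - 0 ^ 2 / 2 * deriv (deriv f) t)| := by congr 1; ring
    _ ≤ _ := this
    _ = _ := by ring

lemma aux_e1 (x : ℝ) : ‖Complex.exp (Complex.I * x) - 1‖ ≤ |x| := by
  simpa using Real.norm_exp_I_mul_ofReal_sub_one_le (x := x)

lemma aux_nI (x : ℝ) : ‖Complex.exp (Complex.I * x)‖ = 1 := by
  rw [mul_comm]; exact Complex.norm_exp_ofReal_mul_I x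

lemma aux_e2 (x : ℝ) : ‖Complex.exp (Complex.I * x) - 1 - Complex.I * x‖ ≤ 3 * x ^ 2 := by
  by_cases hx : |x| ≤ 1
  · have := Complex.norm_exp_sub_one_sub_id_le (x := Complex.I * x) (by simpa using hx)
    simp only [norm_mul, Complex.norm_I, one_mul, Complex.norm_real, Real.norm_eq_abs,
      sq_abs] at this
    nlinarith [sq_nonneg x]
  · push Not at hx
    have h1 := norm_sub_le (Complex.exp (Complex.I * x) - 1) (Complex.I * x)
    have h2 := aux_e1 x
    simp only [norm_mul, Complex.norm_I, one_mul, Complex.norm_real, Real.norm_eq_abs] at h1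
    nlinarith [sq_abs x]

/-- `e^{i(a+b+r)}` is `e^{ia}(1+ib)` up to `|r| + 3 b²`. -/
lemma aux_e3 (a b r : ℝ) :
    ‖Complex.exp (Complex.I * (a + b + r : ℝ)) - Complex.exp (Complex.I * a) *
      (1 + Complex.I * b)‖ ≤ |r| + 3 * b ^ 2 := by
  have : Complex.exp (Complex.I * (a + b + r : ℝ)) - Complex.exp (Complex.I * a) *
      (1 + Complex.I * b) = Complex.exp (Complex.I * a) * (Complex.exp (Complex.I * b) *
        (Complex.exp (Complex.I * r) - 1) + (Complex.exp (Complex.I * b) - 1 - Complex.I * b)) := by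
    push_cast
    rw [mul_add, mul_add, Complex.exp_add, Complex.exp_add]; ring
  rw [this, norm_mul, aux_nI, one_mul]
  refine (norm_add_le _ _).trans (add_le_add ?_ (aux_e2 b))
  rw [norm_mul, aux_nI, one_mul]; exact aux_e1 r

lemma aux_main (h a b P Q M : ℝ) (Ep Em : ℂ) (z0 z1 zp zm : Fin 3 → ℂ) (hh : 0 < h)
    (hEp : ‖Ep‖ = 1) (hEm : ‖Em‖ = 1) (hM : 0 ≤ M) (hP0 : 0 ≤ P)
    (hP : ‖Ep - Complex.exp (Complex.I * a) * (1 + Complex.I * b)‖ ≤ P * h ^ 2)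
    (hm : ‖Em - Complex.exp (Complex.I * (-a : ℝ)) * (1 + Complex.I * b)‖ ≤ P * h ^ 2)
    (hb : |b| ≤ Q * h)
    (hz0 : ‖z0‖ ≤ M) (hz1 : ‖z1‖ ≤ M) (hzp : ‖zp - z0 - h • z1‖ ≤ M * h ^ 2)
    (hzm : ‖zm - z0 + h • z1‖ ≤ M * h ^ 2) :
    ‖(2 * h)⁻¹ • (Ep • zp - Em • zm) - ((Complex.I / h * Real.sin a - b / h * Real.sin a) • z0
      + (Real.cos a : ℂ) • z1)‖ ≤ h * (M + P * (M * (1 + h)) + Q * M) := by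
  have hhC : (h : ℂ) ≠ 0 := by exact_mod_cast hh.ne'
  have e1 : Complex.exp (Complex.I * a) = Real.cos a + Real.sin a * Complex.I := by
    rw [mul_comm, Complex.exp_mul_I]; simp
  have e2 : Complex.exp (Complex.I * (-a : ℝ)) = Real.cos a - Real.sin a * Complex.I := by
    rw [mul_comm, Complex.exp_mul_I]; simp [sub_eq_add_neg]
  have key : (2 * h)⁻¹ • (Ep • zp - Em • zm) - ((Complex.I / h * Real.sin a
      - b / h * Real.sin a) • z0 + (Real.cos a : ℂ) • z1) =
      (2 * h)⁻¹ • ((Ep • (zp - z0 - h • z1) - Em • (zm - z0 + h • z1))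
        + ((Ep - Complex.exp (Complex.I * a) * (1 + Complex.I * b)) • (z0 + h • z1)
        - (Em - Complex.exp (Complex.I * (-a : ℝ)) * (1 + Complex.I * b)) • (z0 - h • z1)))
      + (Complex.I * b * Real.cos a) • z1 := by
    rw [e1, e2]
    ext i
    simp only [Pi.add_apply, Pi.sub_apply, Pi.smul_apply, smul_eq_mul, Complex.real_smul]
    generalize Real.cos a = c
    generalize Real.sin a = s
    push_cast
    field_simp
    ring_nf
    simp only [Complex.I_sq]
    ring
  rw [key]
  have hz : ‖z0 + h • z1‖ ≤ M * (1 + h) := by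
    refine (norm_add_le _ _).trans ?_
    rw [norm_smul, Real.norm_of_nonneg hh.le]; nlinarith
  have hz' : ‖z0 - h • z1‖ ≤ M * (1 + h) := by
    refine (norm_sub_le _ _).trans ?_
    rw [norm_smul, Real.norm_of_nonneg hh.le]; nlinarith
  have i1 : ‖Ep • (zp - z0 - h • z1) - Em • (zm - z0 + h • z1)‖ ≤ 2 * (M * h ^ 2) := by
    refine (norm_sub_le _ _).trans ?_
    rw [norm_smul, norm_smul, hEp, hEm]; linarith
  have i2 : ‖(Ep - Complex.exp (Complex.I * a) * (1 + Complex.I * b)) • (z0 + h • z1)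
        - (Em - Complex.exp (Complex.I * (-a : ℝ)) * (1 + Complex.I * b)) • (z0 - h • z1)‖
      ≤ 2 * (P * h ^ 2 * (M * (1 + h))) := by
    refine (norm_sub_le _ _).trans ?_
    rw [norm_smul, norm_smul, two_mul]
    gcongr
  have i3 : ‖(Complex.I * b * Real.cos a) • z1‖ ≤ Q * h * M := by
    rw [norm_smul, norm_mul, norm_mul, Complex.norm_I, one_mul, Complex.norm_real,
      Complex.norm_real, Real.norm_eq_abs, Real.norm_eq_abs]
    have h1 : |b| * |Real.cos a| ≤ Q * h :=
      (mul_le_of_le_one_right (abs_nonneg _) (Real.abs_cos_le_one a)).trans hb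
    exact mul_le_mul h1 hz1 (norm_nonneg _) ((abs_nonneg _).trans hb)
  refine (norm_add_le _ _).trans ?_
  rw [norm_smul, Real.norm_of_nonneg (by positivity)]
  have i4 := (norm_add_le _ _).trans (add_le_add i1 i2)
  have i5 := mul_le_mul_of_nonneg_left i4 (show 0 ≤ (2 * h)⁻¹ by positivity)
  refine (add_le_add i5 i3).trans (le_of_eq ?_)
  field_simp

lemma aux_r (κ K N M ε h ρ : ℝ) (hκ : |κ| ≤ K) (hε : 0 < ε) (hh : 0 < h) (hN : h / ε ≤ N)
    (hM : 0 ≤ M) (hρ : |ρ| ≤ M * h ^ 3) : |κ * ρ / ε| ≤ K * M * N * h ^ 2 := by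
  have hK : 0 ≤ K := (abs_nonneg _).trans hκ
  rw [abs_div, abs_mul, abs_of_pos hε]
  calc |κ| * |ρ| / ε ≤ K * (M * h ^ 3) / ε := by gcongr
    _ = K * M * h ^ 2 * (h / ε) := by ring
    _ ≤ K * M * h ^ 2 * N := by gcongr
    _ = _ := by ring

/-- Leading-order expansion of the symmetric difference quotient of a
modulated function `y(t) = e^{ikφ(t)/ε} z(t)`: with `η = h/ε`,
`δ_{2h} y(t) = e^{ikφ(t)/ε} [((i/(εη)) sin(kηφ̇(t)) − (kη/2) sin(kηφ̇(t)) φ̈(t)) z(t)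
+ cos(kηφ̇(t)) ż(t)] + O(ε)`, where the `O(ε)`-constant depends only on `|k|`, an upper bound
for `η`, and bounds for `φ`, `z` and their derivatives up to order 3 on `[t−h, t+h]`. -/
theorem stmt3 (kabs : ℕ) (ηmax Mb : ℝ) :
    ∃ C : ℝ, ∀ k : ℤ, |k| ≤ (kabs : ℤ) →
      ∀ ε h : ℝ, 0 < ε → ε ≤ 1 → 0 < h → h / ε ≤ ηmax →
      ∀ (φ : ℝ → ℝ) (z : ℝ → Fin 3 → ℂ), ContDiff ℝ (⊤ : ℕ∞) φ → ContDiff ℝ (⊤ : ℕ∞) z →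
      ∀ t : ℝ,
        (∀ s ∈ Set.Icc (t - h) (t + h), ∀ m ≤ 3,
          |iteratedDeriv m φ s| ≤ Mb ∧ ‖iteratedDeriv m z s‖ ≤ Mb) →
        (let η := h / ε
         let y : ℝ → Fin 3 → ℂ := fun s => Complex.exp (Complex.I * k * φ s / ε) • z s
         ‖(2 * h)⁻¹ • (y (t + h) - y (t - h)) -
            Complex.exp (Complex.I * k * φ t / ε) •
              ((Complex.I / (ε * η) * Real.sin (k * η * deriv φ t) -
                  (k * η / 2) * Real.sin (k * η * deriv φ t) * deriv (deriv φ) t) • z t +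
                (Real.cos (k * η * deriv φ t) : ℂ) • deriv z t)‖ ≤ C * ε) := by
  set K : ℝ := (kabs : ℝ) with hKdef
  set P : ℝ := K * Mb * ηmax + 3 * (K * ηmax * Mb) ^ 2 with hPdef
  refine ⟨ηmax * (Mb + P * (Mb * (1 + ηmax)) + K * ηmax * Mb * Mb), ?_⟩
  intro k hk ε h hε hε1 hh hη φ z hφ hz t hbd
  intro η y
  have htI : t ∈ Set.Icc (t - h) (t + h) := ⟨by linarith, by linarith⟩
  have hpI : t + h ∈ Set.Icc (t - h) (t + h) := ⟨by linarith, by linarith⟩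
  have hmI : t - h ∈ Set.Icc (t - h) (t + h) := ⟨by linarith, by linarith⟩
  have hM : 0 ≤ Mb := (abs_nonneg _).trans (hbd t htI 0 (by norm_num)).1
  have hη0 : 0 < η := div_pos hh hε
  have hN : 0 < ηmax := hη0.trans_le hη
  have hK : 0 ≤ K := Nat.cast_nonneg _
  have hP0 : 0 ≤ P := by positivity
  have hκ : |(k : ℝ)| ≤ K := by rw [hKdef]; exact_mod_cast hk
  have hhε : h ≤ ηmax * ε := (div_le_iff₀ hε).1 hη
  have hhN : h ≤ ηmax := hhε.trans (mul_le_of_le_one_right hN.le hε1)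
  have hφ1 : ContDiff ℝ (⊤ : ℕ∞) (deriv φ) := (contDiff_infty_iff_deriv.1 hφ).2
  have hφ2 : ContDiff ℝ (⊤ : ℕ∞) (deriv (deriv φ)) := (contDiff_infty_iff_deriv.1 hφ1).2
  have hz1 : ContDiff ℝ (⊤ : ℕ∞) (deriv z) := (contDiff_infty_iff_deriv.1 hz).2
  have d0 := (contDiff_infty_iff_deriv.1 hφ).1
  have d1 := (contDiff_infty_iff_deriv.1 hφ1).1
  have d2 := (contDiff_infty_iff_deriv.1 hφ2).1
  have w0 := (contDiff_infty_iff_deriv.1 hz).1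
  have w1 := (contDiff_infty_iff_deriv.1 hz1).1
  have T := aux_t3 φ t h Mb hh hM d0 d1 d2 (fun s hs => by
    have := (hbd s hs 3 le_rfl).1
    simpa [iteratedDeriv_succ, iteratedDeriv_zero] using this)
  have W := aux_t2 z t h Mb hh hM w0 w1 (fun s hs => by
    have := (hbd s hs 2 (by norm_num)).2
    simpa only [iteratedDeriv_succ, iteratedDeriv_zero] using this)
  have Tp := T _ hpI
  have Tm := T _ hmI
  have Wp := W _ hpI
  have Wm := W _ hmI
  have B2 : |deriv (deriv φ) t| ≤ Mb := by
    have := (hbd t htI 2 (by norm_num)).1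
    simpa only [iteratedDeriv_succ, iteratedDeriv_zero] using this
  have Z0 : ‖z t‖ ≤ Mb := by
    have := (hbd t htI 0 (by norm_num)).2
    simpa only [iteratedDeriv_zero] using this
  have Z1 : ‖deriv z t‖ ≤ Mb := by
    have := (hbd t htI 1 (by norm_num)).2
    simpa only [iteratedDeriv_one] using this
  have Rp := aux_r k K ηmax Mb ε h _ hκ hε hh hη hM Tp
  have Rm := aux_r k K ηmax Mb ε h _ hκ hε hh hη hM Tm
  set a : ℝ := k * η * deriv φ t with ha
  set b : ℝ := k * η * h / 2 * deriv (deriv φ) t with hbdef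
  have hb : |b| ≤ K * ηmax * Mb * h := by
    rw [hbdef, abs_mul, abs_div, abs_mul, abs_mul, abs_of_pos hη0, abs_of_pos hh]
    calc |(k : ℝ)| * η * h / |2| * |deriv (deriv φ) t| ≤ K * ηmax * h / |2| * Mb := by gcongr
      _ = K * ηmax * Mb * h / 2 := by rw [abs_two]; ring
      _ ≤ _ := half_le_self (by positivity)
  have hb2 : b ^ 2 ≤ (K * ηmax * Mb * h) ^ 2 := sq_le_sq' (by linarith [neg_abs_le b])
    ((le_abs_self b).trans hb)
  have hεC : (ε : ℂ) ≠ 0 := by exact_mod_cast hε.ne'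
  have hhC : (h : ℂ) ≠ 0 := by exact_mod_cast hh.ne'
  set rp : ℝ := k * (φ (t + h) - φ t - (t + h - t) * deriv φ t
    - (t + h - t) ^ 2 / 2 * deriv (deriv φ) t) / ε with hrp
  set rm : ℝ := k * (φ (t - h) - φ t - (t - h - t) * deriv φ t
    - (t - h - t) ^ 2 / 2 * deriv (deriv φ) t) / ε with hrm
  have Ep : Complex.exp (Complex.I * k * φ (t + h) / ε) =
      Complex.exp (Complex.I * k * φ t / ε) * Complex.exp (Complex.I * (a + b + rp : ℝ)) := by
    rw [← Complex.exp_add]; congr 1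
    simp only [ha, hbdef, hrp, η]; push_cast; field_simp; ring
  have Em : Complex.exp (Complex.I * k * φ (t - h) / ε) =
      Complex.exp (Complex.I * k * φ t / ε) * Complex.exp (Complex.I * (-a + b + rm : ℝ)) := by
    rw [← Complex.exp_add]; congr 1
    simp only [ha, hbdef, hrm, η]; push_cast; field_simp; ring
  have main := aux_main h a b P (K * ηmax * Mb) Mb (Complex.exp (Complex.I * (a + b + rp : ℝ)))
    (Complex.exp (Complex.I * (-a + b + rm : ℝ))) (z t) (deriv z t) (z (t + h)) (z (t - h)) hh
    (aux_nI _) (aux_nI _) hM hP0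
    ((aux_e3 a b rp).trans (by rw [hPdef]; nlinarith))
    ((aux_e3 (-a) b rm).trans (by rw [hPdef]; nlinarith)) hb Z0 Z1
    (by simpa using Wp) (by
      have e : t - h - t = -h := by ring
      rw [e, neg_smul, sub_neg_eq_add] at Wm; exact Wm)
  have hE0 : ‖Complex.exp (Complex.I * k * φ t / ε)‖ = 1 := by
    have := aux_nI (k * φ t / ε)
    rw [← this]; congr 2; push_cast; ring
  have c1 : Complex.I / (ε * η : ℂ) = Complex.I / h := by
    congr 1; simp only [η]; push_cast; field_simp
  have c2 : (k * η / 2 : ℂ) * Real.sin a * deriv (deriv φ) t = b / h * Real.sin a := by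
    simp only [hbdef]; push_cast; field_simp
  have fin : (2 * h)⁻¹ • (y (t + h) - y (t - h)) -
      Complex.exp (Complex.I * k * φ t / ε) •
        ((Complex.I / (ε * η) * Real.sin a -
          (k * η / 2) * Real.sin a * deriv (deriv φ) t) • z t +
          (Real.cos a : ℂ) • deriv z t) = Complex.exp (Complex.I * k * φ t / ε) •
      ((2 * h)⁻¹ • (Complex.exp (Complex.I * (a + b + rp : ℝ)) • z (t + h)
        - Complex.exp (Complex.I * (-a + b + rm : ℝ)) • z (t - h))
        - ((Complex.I / h * Real.sin a - b / h * Real.sin a) • z t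
      + (Real.cos a : ℂ) • deriv z t)) := by
    rw [c1, c2]
    simp only [y]
    rw [Ep, Em, smul_sub (Complex.exp (Complex.I * k * φ t / ε)), mul_smul, mul_smul, ← smul_sub,
      smul_comm]
  rw [fin, norm_smul, hE0, one_mul]
  refine main.trans ?_
  calc h * (Mb + P * (Mb * (1 + h)) + K * ηmax * Mb * Mb)
      ≤ (ηmax * ε) * (Mb + P * (Mb * (1 + ηmax)) + K * ηmax * Mb * Mb) := by gcongr
    _ = _ := by ring
end
end

section
/- Let φ and z be smooth (z with values in ℂ³), let ε ∈ (0,1], h > 0, η = h/ε, and let k be an integer; set y(t) = e^{ikφ(t)/ε} z(t). Then there exists a constant C, depending only on |k|, an upper bound for η, and bounds for φ and z and their derivatives up to order 4 on [t−h, t+h], such that | (y(t+h) − 2y(t) + y(t−h))/h² − e^{ikφ(t)/ε} [ ( −(4/(ε²η²)) sin²(kη φ̇(t)/2) + (ik/ε) cos(kη φ̇(t)) φ̈(t) ) z(t) + (2i/(εη)) sin(kη φ̇(t)) ż(t) ] | ≤ C. -/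
noncomputable section

lemma taylor_aux {E : Type*} [NormedAddCommGroup E] [NormedSpace ℝ E] (f : ℝ → E)
    (hf : ContDiff ℝ (⊤ : ℕ∞) f) (t h M σ : ℝ) (hh : 0 < h) (hσ : |σ| = 1) (n : ℕ)
    (hM : ∀ s ∈ Set.Icc (t - h) (t + h), ‖iteratedDeriv (n + 1) f s‖ ≤ M) :
    ‖f (t + σ * h) - ∑ j ∈ Finset.range (n + 1),
      ((j.factorial : ℝ)⁻¹ * (σ * h) ^ j) • iteratedDeriv j f t‖ ≤ M * h ^ (n + 1) := by
  set F : ℝ → E := fun u => f (t + u) with hF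
  set g : ℝ → E := fun s => F (σ * s) with hg
  have hFc : ContDiff ℝ (⊤ : ℕ∞) F := by
    rw [hF]; fun_prop
  have hgc : ContDiff ℝ (⊤ : ℕ∞) g := by
    rw [hg]; fun_prop
  have hder : ∀ j s, iteratedDeriv j g s = σ ^ j • iteratedDeriv j f (t + σ * s) := by
    intro j s
    have h1 := iteratedDeriv_comp_const_smul (𝕜 := ℝ) (n := j) (f := F) (hFc.of_le (by exact_mod_cast le_top)) σ
    have h1' := congrFun h1 s
    rw [hg, h1', hF, iteratedDeriv_comp_const_add]
  have hw : ∀ j, ∀ s ∈ Set.Icc 0 h, iteratedDerivWithin j g (Set.Icc 0 h) s = iteratedDeriv j g s := by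
    intro j s hs
    exact iteratedDerivWithin_eq_iteratedDeriv (uniqueDiffOn_Icc hh)
      ((hgc.of_le (by exact_mod_cast le_top)).contDiffAt) hs
  have hfac : (1:ℝ) ≤ n.factorial := by exact_mod_cast Nat.succ_le_of_lt n.factorial_pos
  have key := taylor_mean_remainder_bound (f := g) (a := 0) (b := h) (C := M) (x := h) (n := n)
    hh.le ((hgc.of_le (by exact_mod_cast le_top)).contDiffOn) ⟨hh.le, le_rfl⟩ (by
      intro y hy
      rw [hw _ _ hy, hder, norm_smul, norm_pow, Real.norm_eq_abs, hσ, one_pow, one_mul]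
      apply hM
      have : |σ * y| ≤ h := by rw [abs_mul, hσ, one_mul, abs_of_nonneg hy.1]; exact hy.2
      have := abs_le.1 this
      constructor <;> linarith)
  have hM0 : 0 ≤ M := le_trans (norm_nonneg _) (hM t ⟨by linarith, by linarith⟩)
  have hT : taylorWithinEval g n (Set.Icc 0 h) 0 h = ∑ j ∈ Finset.range (n + 1),
      ((j.factorial : ℝ)⁻¹ * (σ * h) ^ j) • iteratedDeriv j f t := by
    rw [taylor_within_apply]
    refine Finset.sum_congr rfl fun j _ => ?_
    rw [hw _ _ ⟨le_rfl, hh.le⟩, hder, smul_smul]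
    simp only [mul_zero, add_zero, sub_zero]
    congr 1
    rw [mul_pow]; ring
  rw [hT, sub_zero] at key
  refine key.trans ?_
  exact div_le_self (by positivity) hfac

lemma exp_aux (a : ℝ) : ‖Complex.exp (Complex.I * a) - 1 - Complex.I * a‖ ≤ 3 * a ^ 2 := by
  by_cases h : |a| ≤ 1
  · have := Complex.norm_exp_sub_one_sub_id_le (x := Complex.I * a) (by simpa using h)
    refine this.trans ?_
    simp
    nlinarith [sq_nonneg a]
  · push Not at h
    have h1 : ‖Complex.exp (Complex.I * a)‖ = 1 := by
      rw [mul_comm]; exact Complex.norm_exp_ofReal_mul_I a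
    have h2 : ‖Complex.exp (Complex.I * a) - 1 - Complex.I * a‖ ≤ 1 + 1 + |a| := by
      refine (norm_sub_le _ _).trans ?_
      refine add_le_add ((norm_sub_le _ _).trans ?_) ?_
      · simp [h1]
      · simp
    refine h2.trans ?_
    rw [← sq_abs]; nlinarith

set_option maxHeartbeats 1000000 in
lemma side_aux (K N M : ℝ) (k : ℤ) (hk : |(k:ℝ)| ≤ K) (ε h : ℝ) (hε : 0 < ε) (hε1 : ε ≤ 1)
    (hh : 0 < h) (hN : h / ε ≤ N) (φ : ℝ → ℝ) (z : ℝ → Fin 3 → ℂ)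
    (hφ : ContDiff ℝ (⊤ : ℕ∞) φ) (hz : ContDiff ℝ (⊤ : ℕ∞) z) (t : ℝ)
    (hb : ∀ s ∈ Set.Icc (t - h) (t + h), ∀ m ≤ 4,
          |iteratedDeriv m φ s| ≤ M ∧ ‖iteratedDeriv m z s‖ ≤ M) (σ : ℝ) (hσ : |σ| = 1) :
    ‖Complex.exp (Complex.I * k * φ (t + σ * h) / ε) • z (t + σ * h) -
      Complex.exp (Complex.I * k * φ t / ε) • Complex.exp (σ * (Complex.I * (k * (h / ε) * deriv φ t : ℝ))) •
        ((1 + Complex.I * (k * h ^ 2 * deriv (deriv φ) t / (2 * ε) : ℝ)) • z t + (σ * h : ℂ) • deriv z t)‖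
      ≤ ((3 * (K * N * M + K * N ^ 2 * M) ^ 2 + K * N * M) * M + (1 + K * N ^ 2 * M) * M + K * N * M * M) * h ^ 2 := by
  have ht : t ∈ Set.Icc (t - h) (t + h) := ⟨by linarith, by linarith⟩
  have hM0 : 0 ≤ M := le_trans (abs_nonneg _) (hb t ht 0 (by norm_num)).1
  have hK0 : 0 ≤ K := le_trans (abs_nonneg _) hk
  have hη0 : 0 < h / ε := by positivity
  have hN0 : 0 < N := lt_of_lt_of_le hη0 hN
  have hσ2 : σ ^ 2 = 1 := by rw [← sq_abs, hσ, one_pow]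
  have hhN : h ≤ N := le_trans ((le_div_iff₀ hε).2 (by nlinarith)) hN
  have hts : t + σ * h ∈ Set.Icc (t - h) (t + h) := by
    have : |σ * h| ≤ h := by rw [abs_mul, hσ, one_mul, abs_of_pos hh]
    have := abs_le.1 this
    constructor <;> linarith
  have T1 := taylor_aux φ hφ t h M σ hh hσ 2 (fun s hs => (hb s hs 3 (by norm_num)).1)
  have T2 := taylor_aux z hz t h M σ hh hσ 1 (fun s hs => (hb s hs 2 (by norm_num)).2)
  have i2 : iteratedDeriv 2 φ t = deriv (deriv φ) t := by
    rw [iteratedDeriv_succ, iteratedDeriv_one]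
  simp only [Finset.sum_range_succ, Finset.sum_range_zero, iteratedDeriv_zero, iteratedDeriv_one,
    i2, smul_eq_mul, mul_pow, hσ2] at T1 T2
  norm_num at T1 T2
  have hz' := (hb t ht 1 (by norm_num)).2
  have hφ2 := (hb t ht 2 (by norm_num)).1
  have hzs := (hb _ hts 0 (by norm_num)).2
  rw [iteratedDeriv_one] at hz'
  rw [i2] at hφ2
  rw [iteratedDeriv_zero] at hzs
  set p1 := deriv φ t
  set p2 := deriv (deriv φ) t
  set z1 := deriv z t
  set zs := z (t + σ * h)
  obtain ⟨r, hr⟩ : ∃ r, r = φ (t + σ * h) - (φ t + σ * h * p1 + 1 / 2 * h ^ 2 * p2) := ⟨_, rfl⟩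
  obtain ⟨w, hw⟩ : ∃ w, w = zs - (z t + (σ * h) • z1) := ⟨_, rfl⟩
  have hrb : |r| ≤ M * h ^ 3 := by rw [hr]; exact T1
  have hwb : ‖w‖ ≤ M * h ^ 2 := by rw [hw]; exact T2
  have hφs : φ (t + σ * h) = φ t + σ * h * p1 + 1 / 2 * h ^ 2 * p2 + r := by rw [hr]; ring
  obtain ⟨b, hbd⟩ : ∃ b : ℝ, b = k * h ^ 2 * p2 / (2 * ε) := ⟨_, rfl⟩
  obtain ⟨c, hcd⟩ : ∃ c : ℝ, c = k * r / ε := ⟨_, rfl⟩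
  rw [← hbd]
  have hbb : |b| ≤ K * N * M * h := by
    have e1 : b = k * (h / ε) * p2 * h / 2 := by rw [hbd]; field_simp
    have : |b| = |(k:ℝ)| * (h / ε) * |p2| * h / 2 := by
      rw [e1, abs_div, abs_mul, abs_mul, abs_mul, abs_of_pos hη0, abs_of_pos hh]; norm_num
    rw [this]
    have : |(k:ℝ)| * (h / ε) * |p2| * h ≤ K * N * M * h := by gcongr
    have : 0 ≤ |(k:ℝ)| * (h / ε) * |p2| * h := by positivity
    linarith
  have hcb : |c| ≤ K * N * M * h ^ 2 := by
    have : |c| = |(k:ℝ)| * |r| / ε := by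
      rw [hcd, abs_div, abs_mul, abs_of_pos hε]
    rw [this]
    calc |(k:ℝ)| * |r| / ε ≤ K * (M * h ^ 3) / ε := by gcongr
      _ = K * (h / ε) * M * h ^ 2 := by field_simp
      _ ≤ _ := by gcongr
  have hab : |b + c| ≤ (K * N * M + K * N ^ 2 * M) * h := by
    have : K * N * M * h ^ 2 ≤ K * N ^ 2 * M * h := by
      have : K * N * M * h * h ≤ K * N * M * h * N := by gcongr
      nlinarith
    linarith [abs_add_le b c]
  have hab2 : (b + c) ^ 2 ≤ (K * N * M + K * N ^ 2 * M) ^ 2 * h ^ 2 := by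
    rw [← sq_abs, ← mul_pow]; gcongr
  obtain ⟨ρ, hρ⟩ : ∃ ρ, ρ = Complex.exp (Complex.I * (b + c : ℝ)) - 1 - Complex.I * b := ⟨_, rfl⟩
  have hρb : ‖ρ‖ ≤ (3 * (K * N * M + K * N ^ 2 * M) ^ 2 + K * N * M) * h ^ 2 := by
    have : ρ = (Complex.exp (Complex.I * (b + c : ℝ)) - 1 - Complex.I * (b + c : ℝ)) + Complex.I * c := by
      rw [hρ]; push_cast; ring
    rw [this]
    refine (norm_add_le _ _).trans ?_
    have h1 := exp_aux (b + c)
    have h2 : ‖Complex.I * (c:ℂ)‖ = |c| := by simp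
    rw [h2]; nlinarith
  have hexp : Complex.exp (Complex.I * k * φ (t + σ * h) / ε) =
      Complex.exp (Complex.I * k * φ t / ε) * Complex.exp (σ * (Complex.I * (k * (h / ε) * p1 : ℝ))) * (1 + Complex.I * b + ρ) := by
    have : 1 + Complex.I * b + ρ = Complex.exp (Complex.I * (b + c : ℝ)) := by rw [hρ]; ring
    rw [this, ← Complex.exp_add, ← Complex.exp_add, hφs, hbd, hcd]
    congr 1
    have : (ε:ℂ) ≠ 0 := by exact_mod_cast hε.ne'
    push_cast
    field_simp
    ring
  have hzsum : zs = z t + (σ * h : ℂ) • z1 + w := by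
    rw [hw]
    have : (σ * h : ℂ) • z1 = (σ * h) • z1 := by
      ext i; simp
    rw [this]; abel
  have hP : ‖Complex.exp (Complex.I * k * φ t / ε)‖ = 1 := by
    have : Complex.I * k * φ t / ε = ((k * φ t / ε : ℝ) : ℂ) * Complex.I := by push_cast; ring
    rw [this]; exact Complex.norm_exp_ofReal_mul_I _
  have hQ : ‖Complex.exp (σ * (Complex.I * (k * (h / ε) * p1 : ℝ)))‖ = 1 := by
    have : σ * (Complex.I * (k * (h / ε) * p1 : ℝ)) = ((σ * (k * (h / ε) * p1) : ℝ) : ℂ) * Complex.I := by push_cast; ring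
    rw [this]; exact Complex.norm_exp_ofReal_mul_I _
  have hid : Complex.exp (Complex.I * k * φ (t + σ * h) / ε) • zs -
      Complex.exp (Complex.I * k * φ t / ε) • Complex.exp (σ * (Complex.I * (k * (h / ε) * p1 : ℝ))) •
        ((1 + Complex.I * b) • z t + (σ * h : ℂ) • z1) =
      (Complex.exp (Complex.I * k * φ t / ε) * Complex.exp (σ * (Complex.I * (k * (h / ε) * p1 : ℝ)))) •
        (ρ • zs + (1 + Complex.I * b) • w + (Complex.I * b * (σ * h)) • z1) := by
    rw [hexp]
    generalize Complex.exp (Complex.I * k * φ t / ε) = P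
    generalize Complex.exp (σ * (Complex.I * (k * (h / ε) * p1 : ℝ))) = Q
    have hw2 : w = zs - (z t + (σ * h : ℂ) • z1) := by rw [hzsum]; abel
    rw [hw2]
    module
  rw [hid, norm_smul, norm_mul, hP, hQ, one_mul, one_mul]
  have n1 : ‖ρ • zs‖ ≤ (3 * (K * N * M + K * N ^ 2 * M) ^ 2 + K * N * M) * h ^ 2 * M := by
    rw [norm_smul]; gcongr
  have n2 : ‖(1 + Complex.I * b) • w‖ ≤ (1 + K * N ^ 2 * M) * (M * h ^ 2) := by
    rw [norm_smul]
    gcongr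
    refine (norm_add_le _ _).trans ?_
    simp only [norm_one, norm_mul, Complex.norm_I, one_mul, Complex.norm_real, Real.norm_eq_abs]
    have h3 : K * N * M * h ≤ K * N * M * N := by gcongr
    have h4 : K * N * M * N = K * N ^ 2 * M := by ring
    linarith
  have n3 : ‖(Complex.I * b * (σ * h)) • z1‖ ≤ K * N * M * h * h * M := by
    rw [norm_smul]
    simp only [norm_mul, Complex.norm_I, one_mul, Complex.norm_real, Real.norm_eq_abs, hσ, abs_of_pos hh]
    gcongr
  refine (norm_add₃_le).trans ?_
  refine (add_le_add (add_le_add n1 n2) n3).trans (le_of_eq ?_)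
  ring




/-- Leading-order expansion of the second difference quotient of a
modulated function `y(t) = e^{ikφ(t)/ε} z(t)`: with `η = h/ε`,
`δ_h² y(t) = e^{ikφ(t)/ε} [(−(4/(ε²η²)) sin²(kηφ̇(t)/2) + (ik/ε) cos(kηφ̇(t)) φ̈(t)) z(t)
+ (2i/(εη)) sin(kηφ̇(t)) ż(t)] + O(1)`, where the `O(1)`-constant depends only on `|k|`, an
upper bound for `η`, and bounds for `φ`, `z` and their derivatives up to order 4 on
`[t−h, t+h]`. -/
theorem stmt4 (kabs : ℕ) (ηmax Mb : ℝ) :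
    ∃ C : ℝ, ∀ k : ℤ, |k| ≤ (kabs : ℤ) →
      ∀ ε h : ℝ, 0 < ε → ε ≤ 1 → 0 < h → h / ε ≤ ηmax →
      ∀ (φ : ℝ → ℝ) (z : ℝ → Fin 3 → ℂ), ContDiff ℝ (⊤ : ℕ∞) φ → ContDiff ℝ (⊤ : ℕ∞) z →
      ∀ t : ℝ,
        (∀ s ∈ Set.Icc (t - h) (t + h), ∀ m ≤ 4,
          |iteratedDeriv m φ s| ≤ Mb ∧ ‖iteratedDeriv m z s‖ ≤ Mb) →
        (let η := h / ε
         let y : ℝ → Fin 3 → ℂ := fun s => Complex.exp (Complex.I * k * φ s / ε) • z s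
         ‖(h ^ 2)⁻¹ • (y (t + h) - 2 • y t + y (t - h)) -
            Complex.exp (Complex.I * k * φ t / ε) •
              (((-(4 / (ε ^ 2 * η ^ 2)) * Real.sin (k * η * deriv φ t / 2) ^ 2 : ℂ) +
                  Complex.I * k / ε * Real.cos (k * η * deriv φ t) * deriv (deriv φ) t) • z t +
                (2 * Complex.I / (ε * η) * Real.sin (k * η * deriv φ t)) • deriv z t)‖ ≤ C) := by
  refine ⟨2 * ((3 * (kabs * ηmax * Mb + kabs * ηmax ^ 2 * Mb) ^ 2 + kabs * ηmax * Mb) * Mb + (1 + kabs * ηmax ^ 2 * Mb) * Mb + kabs * ηmax * Mb * Mb), ?_⟩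
  intro k hk ε h hε hε1 hh hN φ z hφ hz t hb
  have hk' : |(k:ℝ)| ≤ (kabs : ℝ) := by exact_mod_cast hk
  have A := side_aux kabs ηmax Mb k hk' ε h hε hε1 hh hN φ z hφ hz t hb 1 (by simp)
  have B := side_aux kabs ηmax Mb k hk' ε h hε hε1 hh hN φ z hφ hz t hb (-1) (by simp)
  have e1 : t + 1 * h = t + h := by ring
  have e2 : t + -1 * h = t - h := by ring
  rw [e1] at A
  rw [e2] at B
  intro η y
  set D := (3 * (kabs * ηmax * Mb + kabs * ηmax ^ 2 * Mb) ^ 2 + kabs * ηmax * Mb) * Mb + (1 + kabs * ηmax ^ 2 * Mb) * Mb + kabs * ηmax * Mb * Mb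
  have hs : (Real.sin (k * η * deriv φ t / 2) : ℂ) ^ 2 = (1 - Real.cos (k * η * deriv φ t)) / 2 := by
    have := Real.cos_sq_add_sin_sq (k * η * deriv φ t / 2)
    have h2 := Real.cos_two_mul (k * η * deriv φ t / 2)
    have e : 2 * (k * η * deriv φ t / 2) = k * η * deriv φ t := by ring
    rw [e] at h2
    have : Real.sin (k * η * deriv φ t / 2) ^ 2 = (1 - Real.cos (k * η * deriv φ t)) / 2 := by linarith
    exact_mod_cast this
  have hε' : (ε:ℂ) ≠ 0 := by exact_mod_cast hε.ne'
  have hh' : (h:ℂ) ≠ 0 := by exact_mod_cast hh.ne'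
  have q1 : (4 / (ε ^ 2 * η ^ 2) : ℂ) = 4 / h ^ 2 := by
    simp only [η]; push_cast; field_simp
  have q2 : (2 * Complex.I / (ε * η) : ℂ) = 2 * Complex.I / h := by
    simp only [η]; push_cast; field_simp
  rw [hs, q1, q2]
  change ‖_ - _ • _ • ((1 + Complex.I * ((k * h ^ 2 * deriv (deriv φ) t / (2 * ε) : ℝ) : ℂ)) • z t + _)‖ ≤ _ at A
  have hη : k * (h / ε) * deriv φ t = k * η * deriv φ t := rfl
  rw [hη] at A B
  generalize k * η * deriv φ t = θ at *
  have p1 : Complex.exp (((1:ℝ):ℂ) * (Complex.I * (θ:ℝ))) = Real.cos θ + Real.sin θ * Complex.I := by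
    rw [Complex.ofReal_one, one_mul, mul_comm, Complex.exp_mul_I]; simp
  have p2 : Complex.exp (((-1:ℝ):ℂ) * (Complex.I * (θ:ℝ))) = Real.cos θ - Real.sin θ * Complex.I := by
    have : ((-1:ℝ):ℂ) * (Complex.I * (θ:ℝ)) = (-(θ:ℂ)) * Complex.I := by push_cast; ring
    rw [this, Complex.exp_mul_I]; simp; ring
  rw [p1] at A
  rw [p2] at B
  have hI := Complex.I_sq
  set R1 := Complex.exp (Complex.I * k * φ (t + h) / ε) • z (t + h) -
      Complex.exp (Complex.I * k * φ t / ε) • (Real.cos θ + Real.sin θ * Complex.I : ℂ) •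
        ((1 + Complex.I * (k * h ^ 2 * deriv (deriv φ) t / (2 * ε) : ℝ)) • z t + (((1:ℝ):ℂ) * h : ℂ) • deriv z t) with hR1
  set R2 := Complex.exp (Complex.I * k * φ (t - h) / ε) • z (t - h) -
      Complex.exp (Complex.I * k * φ t / ε) • (Real.cos θ - Real.sin θ * Complex.I : ℂ) •
        ((1 + Complex.I * (k * h ^ 2 * deriv (deriv φ) t / (2 * ε) : ℝ)) • z t + (((-1:ℝ):ℂ) * h : ℂ) • deriv z t) with hR2
  have hid : (h ^ 2)⁻¹ • (y (t + h) - 2 • y t + y (t - h)) -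
            Complex.exp (Complex.I * k * φ t / ε) •
              ((-(4 / (h:ℂ) ^ 2) * ((1 - Real.cos θ) / 2) +
                  Complex.I * k / ε * Real.cos θ * deriv (deriv φ) t) • z t +
                (2 * Complex.I / h * Real.sin θ) • deriv z t) = (h ^ 2)⁻¹ • (R1 + R2) := by
    rw [hR1, hR2]
    simp only [y, two_smul]
    ext i
    simp only [Pi.sub_apply, Pi.add_apply, Pi.smul_apply, smul_eq_mul, Complex.real_smul]
    generalize Complex.exp (Complex.I * k * φ t / ε) = P
    generalize Complex.exp (Complex.I * k * φ (t + h) / ε) = P1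
    generalize Complex.exp (Complex.I * k * φ (t - h) / ε) = P2
    push_cast
    field_simp
    ring
  rw [hid, norm_smul, norm_inv, norm_pow, Real.norm_eq_abs, abs_of_pos hh, inv_mul_le_iff₀ (by positivity)]
  refine (norm_add_le _ _).trans ?_
  linarith
end
end
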